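/- arXiv:1706.08995 — 2 statements merged into one kernel-verified Lean document; each statement's English description precedes it below -/
import Mathlib

section
/- Let W : ℕ → (0, ∞) and let μ be a probability measure on [0, ∞) such that ∫ yⁿ dμ(y) = n! / W(n+1) for every n ∈ ℕ. Then for every x ≥ 0, the series ∑_{n≥0} (−1)ⁿ W(n+1) (x y)ⁿ / (n!)² converges absolutely for μ-almost every y, the resulting function of y is μ-integrable, and ∫ ( ∑_{n≥0} (−1)ⁿ W(n+1) (x y)ⁿ / (n!)² ) dμ(y) = e^{-x}. -/
open MeasureTheory

/-- A countable family of integrable functions whose `L¹` norms are summable has finite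
`∫⁻ ∑ ‖F n‖ₑ`. -/
theorem lintegral_tsum_enorm_ne_top {α E ι : Type*} [MeasurableSpace α] {μ : Measure α}
    [NormedAddCommGroup E] [Countable ι] {F : ι → α → E} (hF : ∀ n, Integrable (F n) μ)
    (hsum : Summable fun n => ∫ a, ‖F n a‖ ∂μ) :
    ∫⁻ a, ∑' n, ‖F n a‖ₑ ∂μ ≠ ⊤ := by
  rw [lintegral_tsum fun n => (hF n).1.enorm]
  simp_rw [← ofReal_integral_norm_eq_lintegral_enorm (hF _)]
  exact hsum.tsum_ofReal_ne_top

theorem ae_summable_norm_of_summable_integral_norm {α E ι : Type*} [MeasurableSpace α]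
    {μ : Measure α} [NormedAddCommGroup E] [Countable ι] {F : ι → α → E}
    (hF : ∀ n, Integrable (F n) μ) (hsum : Summable fun n => ∫ a, ‖F n a‖ ∂μ) :
    ∀ᵐ a ∂μ, Summable fun n => ‖F n a‖ := by
  filter_upwards [ae_lt_top' (AEMeasurable.tsum fun n => (hF n).1.enorm)
    (lintegral_tsum_enorm_ne_top hF hsum)] with a ha
  exact tsum_enorm_ne_top_iff_summable_norm.1 ha.ne

theorem integrable_tsum_of_summable_integral_norm {α E : Type*} [MeasurableSpace α]
    {μ : Measure α} [NormedAddCommGroup E] [CompleteSpace E] {F : ℕ → α → E}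
    (hF : ∀ n, Integrable (F n) μ) (hsum : Summable fun n => ∫ a, ‖F n a‖ ∂μ) :
    Integrable (fun a => ∑' n, F n a) μ := by
  refine ⟨?_, ?_⟩
  · refine aestronglyMeasurable_of_tendsto_ae Filter.atTop
      (f := fun N a => ∑ n ∈ Finset.range N, F n a)
      (fun N => Finset.aestronglyMeasurable_fun_sum _ fun n _ => (hF n).1) ?_
    filter_upwards [ae_summable_norm_of_summable_integral_norm hF hsum] with a ha
    exact ha.of_norm.hasSum.tendsto_sum_nat
  · exact (lintegral_mono fun a => enorm_tsum_le_tsum_enorm).trans_lt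
      (lintegral_tsum_enorm_ne_top hF hsum).lt_top

/-- If `μ` is a probability measure on `[0,∞)` with moments `∫ yⁿ dμ = n!/W(n+1)`, then the series
`∑ₙ (-1)ⁿ W(n+1)(xy)ⁿ/(n!)²` is a.e. absolutely convergent, integrable, and integrates
to `e^{-x}`. -/
theorem stmt_7 (W : ℕ → ℝ) (hW : ∀ n, 0 < W n)
    (μ : Measure ℝ) [IsProbabilityMeasure μ] (hsupp : μ (Set.Iio 0) = 0)
    (hmom_int : ∀ n : ℕ, Integrable (fun y => y ^ n) μ)
    (hmom : ∀ n : ℕ, ∫ y, y ^ n ∂μ = (n.factorial : ℝ) / W (n + 1)) :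
    ∀ x : ℝ, 0 ≤ x →
      (∀ᵐ y ∂μ, Summable (fun n : ℕ =>
          |(-1 : ℝ) ^ n * W (n + 1) * (x * y) ^ n / ((n.factorial : ℝ)) ^ 2|)) ∧
      Integrable (fun y =>
          ∑' n : ℕ, (-1 : ℝ) ^ n * W (n + 1) * (x * y) ^ n / ((n.factorial : ℝ)) ^ 2) μ ∧
      ∫ y, (∑' n : ℕ, (-1 : ℝ) ^ n * W (n + 1) * (x * y) ^ n / ((n.factorial : ℝ)) ^ 2) ∂μ
        = Real.exp (-x) := by
  intro x hx
  obtain ⟨F, hF_def⟩ : ∃ F : ℕ → ℝ → ℝ, ∀ n y,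
      F n y = (-1 : ℝ) ^ n * W (n + 1) * (x * y) ^ n / (n.factorial : ℝ) ^ 2 :=
    ⟨_, fun _ _ => rfl⟩
  simp only [← Real.norm_eq_abs, ← hF_def]
  have hF_eq (n : ℕ) :
      F n = fun y => ((-1 : ℝ) ^ n * W (n + 1) * x ^ n / (n.factorial : ℝ) ^ 2) * y ^ n := by
    funext y
    simp only [hF_def, mul_pow]
    ring
  have hF_int (n : ℕ) : Integrable (F n) μ := by
    rw [hF_eq]
    exact (hmom_int n).const_mul _
  have hF_integral (n : ℕ) : ∫ y, F n y ∂μ = (-x) ^ n / n.factorial := by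
    have hWn := (hW (n + 1)).ne'
    have hn : (n.factorial : ℝ) ≠ 0 := by positivity
    rw [hF_eq, integral_const_mul, hmom, neg_pow x]
    field_simp
  have hnonneg : ∀ᵐ y ∂μ, 0 ≤ y := by
    simpa [ae_iff, Set.Iio] using hsupp
  have hF_norm (n : ℕ) : ∫ y, ‖F n y‖ ∂μ = x ^ n / n.factorial := by
    have hae : (fun y => ‖F n y‖) =ᵐ[μ] fun y => (-1 : ℝ) ^ n * F n y := by
      filter_upwards [hnonneg] with y hy
      have hWn := hW (n + 1)
      have hsq : (-1 : ℝ) ^ n * (-1) ^ n = 1 := by rw [← mul_pow]; norm_num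
      have hpos : 0 ≤ W (n + 1) * (x * y) ^ n / (n.factorial : ℝ) ^ 2 := by positivity
      have hsplit : F n y = (-1) ^ n * (W (n + 1) * (x * y) ^ n / (n.factorial : ℝ) ^ 2) := by
        simp only [hF_def]
        ring
      rw [hsplit, norm_mul, norm_pow, norm_neg, norm_one, one_pow, one_mul,
        Real.norm_of_nonneg hpos, ← mul_assoc, hsq, one_mul]
    rw [integral_congr_ae hae, integral_const_mul, hF_integral, ← mul_div_assoc, ← mul_pow]
    simp
  have hsum : Summable fun n => ∫ y, ‖F n y‖ ∂μ := by
    simp_rw [hF_norm]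
    exact Real.summable_pow_div_factorial x
  refine ⟨ae_summable_norm_of_summable_integral_norm hF_int hsum,
    integrable_tsum_of_summable_integral_norm hF_int hsum, ?_⟩
  rw [← integral_tsum_of_summable_integral_norm hF_int hsum]
  simp_rw [hF_integral]
  rw [Real.exp_eq_exp_ℝ]
  exact (NormedSpace.expSeries_div_hasSum_exp (-x)).tsum_eq
end

section
/- Let θ ∈ (0, 1), 𝔟 ≥ 0, and let t ∈ ℝ satisfy e^{2t} ≥ (𝔟 + 2)/(2 − θ). Then for every integer n ≥ 1, e^{−2(n−1)t} · Γ(n+1+𝔟) · Γ(2−θ) ≤ Γ(n+1−θ) · Γ(2+𝔟). Equivalently, with c_n(u) = Γ(1+u)·Γ(n+1)/Γ(n+1+u), one has e^{−2(n−1)t} · c_1(𝔟) · c_n(−θ) / (c_n(𝔟) · c_1(−θ)) ≤ 1 for all n ≥ 1. -/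
/-- The key Gamma-function estimate for the perturbed spectral gap: for `t` with
`e^{2t} ≥ (𝔟+2)/(2-θ)` and all `n ≥ 1`,
`e^{-2(n-1)t} Γ(n+1+𝔟) Γ(2-θ) ≤ Γ(n+1-θ) Γ(2+𝔟)`. -/
theorem stmt_13 (θ b t : ℝ) (hθ : θ ∈ Set.Ioo (0 : ℝ) 1) (hb : 0 ≤ b)
    (ht : (b + 2) / (2 - θ) ≤ Real.exp (2 * t)) :
    ∀ n : ℕ, 1 ≤ n →
      Real.exp (-2 * ((n : ℝ) - 1) * t) * Real.Gamma ((n : ℝ) + 1 + b) * Real.Gamma (2 - θ)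
        ≤ Real.Gamma ((n : ℝ) + 1 - θ) * Real.Gamma (2 + b) := by
  obtain ⟨hθ0, hθ1⟩ := hθ
  have hE0 : 0 < Real.exp (-2 * t) := Real.exp_pos _
  have hEE : Real.exp (-2 * t) * Real.exp (2 * t) = 1 := by
    rw [← Real.exp_add]
    simp
  have hE2 : Real.exp (-2 * t) * (b + 2) ≤ 2 - θ := by
    rw [div_le_iff₀ (by linarith)] at ht
    calc Real.exp (-2 * t) * (b + 2)
        ≤ Real.exp (-2 * t) * (Real.exp (2 * t) * (2 - θ)) := by gcongr
      _ = 2 - θ := by rw [← mul_assoc, hEE, one_mul]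
  have hE1 : Real.exp (-2 * t) ≤ 1 := by nlinarith
  intro n hn
  induction n, hn using Nat.le_induction with
  | base =>
    norm_num
    rw [mul_comm]
  | succ n hn ih =>
    have hn' : (1 : ℝ) ≤ n := by exact_mod_cast hn
    have hratio : Real.exp (-2 * t) * (n + 1 + b) ≤ n + 1 - θ := by nlinarith
    have hΓb : Real.Gamma (((n + 1 : ℕ) : ℝ) + 1 + b)
        = (n + 1 + b) * Real.Gamma (n + 1 + b) := by
      rw [← Real.Gamma_add_one (by positivity)]
      push_cast
      ring_nf
    have hΓθ : Real.Gamma (((n + 1 : ℕ) : ℝ) + 1 - θ)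
        = (n + 1 - θ) * Real.Gamma (n + 1 - θ) := by
      rw [← Real.Gamma_add_one (by linarith)]
      push_cast
      ring_nf
    have hexp : Real.exp (-2 * (((n + 1 : ℕ) : ℝ) - 1) * t)
        = Real.exp (-2 * t) * Real.exp (-2 * ((n : ℝ) - 1) * t) := by
      rw [← Real.exp_add]
      push_cast
      ring_nf
    have hpos : 0 ≤ Real.exp (-2 * ((n : ℝ) - 1) * t) * Real.Gamma (n + 1 + b)
        * Real.Gamma (2 - θ) := by
      have := Real.Gamma_pos_of_pos (show (0 : ℝ) < n + 1 + b by positivity)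
      have := Real.Gamma_pos_of_pos (show (0 : ℝ) < 2 - θ by linarith)
      positivity
    rw [hΓb, hΓθ, hexp]
    linarith [mul_le_mul hratio ih hpos (by linarith)]
end
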